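/- arXiv:1809.05439 — 2 statements merged into one kernel-verified Lean document; each statement's English description precedes it below -/
import Mathlib

section
/- Let H be the graph with vertex set {x, v1, u1, v2, u2, v3, u3, w1, w3, y1} and edge set {xv1, xv2, xv3, v1u1, v2u2, v3u3, u1u2, u2u3, u1w1, u3w3, w1w3, w1y1}. Let L assign subsets of {1,...,6} to the vertices of H so that L(x) = {1,2,3}, |L(u1)| = 3 and L(u1) ∩ {1,2,3} = {3}, L(u3) = {1,2,5,6}, |L(w3)| = 4, |L(y1)| = 2 and L(y1) ⊆ {3,4,5,6}, and L(v1) = L(v2) = L(v3) = L(u2) = L(w1) = {1,...,6}. Then there exists a 2-element set S ⊆ L(u1) such that 3 ∈ S and S ∩ L(y1) ≠ ∅, and for any such set S, the graph H has a set coloring φ by subsets of {1,...,6} with |φ(v)| ≥ 2 for every vertex v, |φ(x)| = 3, φ(v) ⊆ L(v) for every vertex v of H, and φ(u1) = S. -/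
open SimpleGraph

/-- The graph `H` from Lemma `spe-set`, on the vertices
`x = 0, v₁ = 1, u₁ = 2, v₂ = 3, u₂ = 4, v₃ = 5, u₃ = 6, w₁ = 7, w₃ = 8, y₁ = 9`,
with edge set
`{xv₁, xv₂, xv₃, v₁u₁, v₂u₂, v₃u₃, u₁u₂, u₂u₃, u₁w₁, u₃w₃, w₁w₃, w₁y₁}`. -/
def Hgraph : SimpleGraph (Fin 10) :=
  SimpleGraph.fromEdgeSet
    {s(0, 1), s(0, 3), s(0, 5), s(1, 2), s(3, 4), s(5, 6),
     s(2, 4), s(4, 6), s(2, 7), s(6, 8), s(7, 8), s(7, 9)}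

lemma exists_pair_mem_inter_nonempty :
    ∀ U ∈ Finset.powersetCard 3 {3, 4, 5, 6}, ∀ Y ∈ Finset.powersetCard 2 {3, 4, 5, 6}, 3 ∈ U →
      ∃ S ∈ Finset.powersetCard 2 U, 3 ∈ S ∧ (S ∩ Y : Finset ℕ).Nonempty := by
  decide +kernel

/-- The choice of colors at `u₃`, `w₁` and `w₃`, given the lists `Y` of `y₁` and `W` of `w₃`. -/
lemma exists_disjoint_pairs :
    ∀ a ∈ ({4, 5, 6} : Finset ℕ), ∀ Y ∈ Finset.powersetCard 2 {3, 4, 5, 6},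
      ∀ W ∈ Finset.powersetCard 4 (Finset.Icc 1 6), ({3, a} ∩ Y).Nonempty →
      ∃ i ∈ ({1, 2} : Finset ℕ), ∃ e ∈ ({5, 6} : Finset ℕ),
        ∃ A ∈ Finset.powersetCard 2 (Finset.Icc 1 6 \ ({3, a} ∪ Y)),
          ∃ B ∈ Finset.powersetCard 2 (W \ {i, e}), Disjoint A B := by
  decide +kernel

/-- The choice of colors at `v₁`, `v₂`, `u₂` and `v₃`, given the colors `{3, a}` of `u₁` and
`{i, e}` of `u₃`. -/
lemma exists_pairs_of_mem :
    ∀ a ∈ ({4, 5, 6} : Finset ℕ), ∀ i ∈ ({1, 2} : Finset ℕ), ∀ e ∈ ({5, 6} : Finset ℕ),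
      ∃ V₁ ∈ Finset.powersetCard 2 {4, 5, 6}, ∃ V₂ ∈ Finset.powersetCard 2 {4, 5, 6},
      ∃ V₃ ∈ Finset.powersetCard 2 {4, 5, 6}, ∃ U ∈ Finset.powersetCard 2 (Finset.Icc 1 6),
        Disjoint V₁ {3, a} ∧ Disjoint V₂ U ∧ Disjoint V₃ {i, e} ∧
        Disjoint U {3, a} ∧ Disjoint U {i, e} := by
  decide +kernel

/-- **Lemma (spe-set).** Let `L` assign subsets of `{1,…,6}` to the vertices of `H` with
`L(x) = {1,2,3}`, `|L(u₁)| = 3` and `L(u₁) ∩ {1,2,3} = {3}`, `L(u₃) = {1,2,5,6}`,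
`|L(w₃)| = 4`, `|L(y₁)| = 2` and `L(y₁) ⊆ {3,4,5,6}`, and
`L(v₁) = L(v₂) = L(v₃) = L(u₂) = L(w₁) = {1,…,6}`.  Then there exists a 2-element set
`S ⊆ L(u₁)` with `3 ∈ S` and `S ∩ L(y₁) ≠ ∅`, and for any such `S` the graph `H` has a
set coloring `φ` by subsets of `{1,…,6}` with `|φ(v)| ≥ 2` for all `v`, `|φ(x)| = 3`,
`φ(v) ⊆ L(v)` for all `v`, and `φ(u₁) = S`. -/
theorem spe_set (L : Fin 10 → Finset ℕ)
    (hL : ∀ v, L v ⊆ Finset.Icc 1 6)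
    (hx : L 0 = {1, 2, 3})
    (hu1card : (L 2).card = 3) (hu1 : L 2 ∩ {1, 2, 3} = {3})
    (hu3 : L 6 = {1, 2, 5, 6})
    (hw3 : (L 8).card = 4)
    (hy1card : (L 9).card = 2) (hy1 : L 9 ⊆ {3, 4, 5, 6})
    (hv1 : L 1 = Finset.Icc 1 6) (hv2 : L 3 = Finset.Icc 1 6)
    (hv3 : L 5 = Finset.Icc 1 6) (hu2 : L 4 = Finset.Icc 1 6)
    (hw1 : L 7 = Finset.Icc 1 6) :
    (∃ S : Finset ℕ, S.card = 2 ∧ S ⊆ L 2 ∧ 3 ∈ S ∧ (S ∩ L 9).Nonempty) ∧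
    ∀ S : Finset ℕ, S.card = 2 → S ⊆ L 2 → 3 ∈ S → (S ∩ L 9).Nonempty →
      ∃ φ : Fin 10 → Finset ℕ,
        (∀ v, φ v ⊆ Finset.Icc 1 6) ∧
        (∀ ⦃u v⦄, Hgraph.Adj u v → Disjoint (φ u) (φ v)) ∧
        (∀ v, 2 ≤ (φ v).card) ∧
        (φ 0).card = 3 ∧
        (∀ v, φ v ⊆ L v) ∧
        φ 2 = S := by
  have hu1' : L 2 ⊆ {3, 4, 5, 6} := by
    intro t ht
    have h := Finset.mem_Icc.1 (hL 2 ht)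
    have h' : t ∈ ({1, 2, 3} : Finset ℕ) → t = 3 := fun h' ↦
      Finset.mem_singleton.1 (hu1 ▸ Finset.mem_inter.2 ⟨ht, h'⟩)
    simp only [Finset.mem_insert, Finset.mem_singleton] at h' ⊢
    omega
  have h3 : 3 ∈ L 2 := (Finset.mem_inter.1 (hu1 ▸ Finset.mem_singleton_self 3)).1
  have hY := Finset.mem_powersetCard.2 ⟨hy1, hy1card⟩
  refine ⟨?_, fun S hS hSL h3S hSY ↦ ?_⟩
  · obtain ⟨S, hS, h3S, hSY⟩ := exists_pair_mem_inter_nonempty _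
      (Finset.mem_powersetCard.2 ⟨hu1', hu1card⟩) _ hY h3
    obtain ⟨hSL, hS⟩ := Finset.mem_powersetCard.1 hS
    exact ⟨S, hS, hSL, h3S, hSY⟩
  obtain ⟨a, ha3, rfl⟩ : ∃ a, a ≠ 3 ∧ S = {3, a} := by
    obtain ⟨p, q, hpq, rfl⟩ := Finset.card_eq_two.1 hS
    rcases Finset.mem_insert.1 h3S with rfl | h
    · exact ⟨q, hpq.symm, rfl⟩
    · rw [Finset.mem_singleton] at h
      subst h
      exact ⟨p, hpq, Finset.pair_comm _ _⟩
  have ha : a ∈ ({4, 5, 6} : Finset ℕ) := by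
    have := hu1' (hSL (Finset.mem_insert_of_mem (Finset.mem_singleton_self a)))
    simpa [ha3] using this
  obtain ⟨i, hi, e, he, A, hA, B, hB, hAB⟩ :=
    exists_disjoint_pairs a ha _ hY _ (Finset.mem_powersetCard.2 ⟨hL 8, hw3⟩) hSY
  obtain ⟨V₁, hV₁, V₂, hV₂, V₃, hV₃, U, hU, hV₁a, hV₂U, hV₃e, hUa, hUe⟩ :=
    exists_pairs_of_mem a ha i hi e he
  rw [Finset.mem_powersetCard] at hA hB hV₁ hV₂ hV₃ hU
  obtain ⟨hBW, hBe⟩ := Finset.subset_sdiff.1 hB.1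
  obtain ⟨hAI, hAY⟩ := Finset.subset_sdiff.1 hA.1
  rw [Finset.disjoint_union_right] at hAY
  have hx123 : ∀ V : Finset ℕ, V ⊆ {4, 5, 6} → Disjoint {1, 2, 3} V := fun V hV ↦
    Finset.disjoint_of_subset_right hV (by decide)
  have hI : ({4, 5, 6} : Finset ℕ) ⊆ Finset.Icc 1 6 := by decide
  have hie : ({i, e} : Finset ℕ).card = 2 ∧ ({i, e} : Finset ℕ) ⊆ {1, 2, 5, 6} := by
    simp only [Finset.mem_insert, Finset.mem_singleton] at hi he
    rcases hi with rfl | rfl <;> rcases he with rfl | rfl <;> decide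
  let φ : Fin 10 → Finset ℕ := ![{1, 2, 3}, V₁, {3, a}, V₂, U, V₃, {i, e}, A, B, L 9]
  have hφL : ∀ v, φ v ⊆ L v := by
    intro v
    fin_cases v
    exacts [hx.ge, hv1 ▸ hV₁.1.trans hI, hSL, hv2 ▸ hV₂.1.trans hI, hu2 ▸ hU.1,
      hv3 ▸ hV₃.1.trans hI, hu3 ▸ hie.2, hw1 ▸ hAI, hBW, subset_rfl]
  refine ⟨φ, fun v ↦ (hφL v).trans (hL v), ?_, ?_, rfl, hφL, rfl⟩
  · have key : ∀ p ∈ ({s(0, 1), s(0, 3), s(0, 5), s(1, 2), s(3, 4), s(5, 6),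
        s(2, 4), s(4, 6), s(2, 7), s(6, 8), s(7, 8), s(7, 9)} : Set (Sym2 (Fin 10))),
        ∀ u v, p = s(u, v) → Disjoint (φ u) (φ v) := by
      have of_pair : ∀ u v, Disjoint (φ u) (φ v) →
          ∀ u' v', s(u, v) = s(u', v') → Disjoint (φ u') (φ v') := by
        intro u v h u' v' huv
        rcases Sym2.eq_iff.1 huv with ⟨rfl, rfl⟩ | ⟨rfl, rfl⟩
        exacts [h, h.symm]
      rintro p (rfl | rfl | rfl | rfl | rfl | rfl | rfl | rfl | rfl | rfl | rfl | rfl) <;>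
        apply of_pair
      exacts [hx123 _ hV₁.1, hx123 _ hV₂.1, hx123 _ hV₃.1, hV₁a, hV₂U, hV₃e, hUa.symm, hUe,
        hAY.1.symm, hBe.symm, hAB, hAY.2]
    exact fun u v huv ↦ key _ ((SimpleGraph.fromEdgeSet_adj _).1 huv).1 u v rfl
  · intro v
    fin_cases v
    exacts [Nat.le_succ 2, hV₁.2.ge, hS.ge, hV₂.2.ge, hU.2.ge, hV₃.2.ge, hie.1.ge, hA.2.ge,
      hB.2.ge, hy1card.ge]
end

section
/- Let G be the graph obtained from the wheel with five spokes by subdividing each spoke once; that is, G has vertex set {x, s1, s2, s3, s4, s5, r1, r2, r3, r4, r5}, where x is adjacent to each s_i, each s_i is adjacent to r_i, and r1 r2 r3 r4 r5 forms a 5-cycle. Let k be a positive integer and let φ be a set coloring of G by subsets of {1,...,k} such that |φ(v)| ≥ k/3 for every vertex v of G. Then |φ(x)| ≤ 5k/9. -/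
open SimpleGraph

/-- The wheel with five spokes, each spoke subdivided once: the hub is `x = 0`, the
subdivision vertices are `s₁, …, s₅ = 1, …, 5`, the rim vertices are
`r₁, …, r₅ = 6, …, 10`; `x` is adjacent to each `sᵢ`, each `sᵢ` is adjacent to `rᵢ`, and
`r₁ r₂ r₃ r₄ r₅` forms a 5-cycle. -/
def subdividedWheel : SimpleGraph (Fin 11) :=
  SimpleGraph.fromEdgeSet
    {s(0, 1), s(0, 2), s(0, 3), s(0, 4), s(0, 5),
     s(1, 6), s(2, 7), s(3, 8), s(4, 9), s(5, 10),
     s(6, 7), s(7, 8), s(8, 9), s(9, 10), s(10, 6)}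

/-- If sets placed around a 5-cycle are disjoint whenever adjacent, then every point lies in at
most two of them, so their traces on a finite set `X` have total size at most `2 * #X`. -/
lemma sum_card_inter_le_of_disjoint_five_cycle {α : Type*} [DecidableEq α]
    (X : Finset α) (A : Fin 5 → Finset α) (hA : ∀ i, Disjoint (A i) (A (i + 1))) :
    ∑ i, (X ∩ A i).card ≤ 2 * X.card := by
  simp_rw [← Finset.filter_mem_eq_inter, Finset.card_filter]
  rw [Finset.sum_comm, mul_comm, ← smul_eq_mul]
  refine Finset.sum_le_card_nsmul _ _ _ fun c _ => ?_
  have h : ∀ i, c ∈ A i → c ∉ A (i + 1) := fun i => fun hi => Finset.disjoint_left.mp (hA i) hi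
  have h0 : c ∈ A 0 → c ∉ A 1 := h 0
  have h1 : c ∈ A 1 → c ∉ A 2 := h 1
  have h2 : c ∈ A 2 → c ∉ A 3 := h 2
  have h3 : c ∈ A 3 → c ∉ A 4 := h 3
  have h4 : c ∈ A 4 → c ∉ A 0 := h 4
  simp only [Fin.sum_univ_five]
  split_ifs <;> simp_all

/-- If `S` is disjoint from both `X` and `R`, then `S`, `X` and `R \ X` are pairwise disjoint. -/
lemma card_add_card_add_card_le_of_disjoint {α : Type*} [DecidableEq α]
    {U X S R : Finset α} (hX : X ⊆ U) (hS : S ⊆ U) (hR : R ⊆ U)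
    (hXS : Disjoint X S) (hSR : Disjoint S R) :
    X.card + S.card + R.card ≤ U.card + (X ∩ R).card := by
  have hSXR : Disjoint S (X ∪ R) := Finset.disjoint_union_right.mpr ⟨hXS.symm, hSR⟩
  have hle := Finset.card_le_card
    (Finset.union_subset hS (Finset.union_subset hX hR))
  rw [Finset.card_union_of_disjoint hSXR] at hle
  have := Finset.card_union_add_card_inter X R
  omega

/-- If `φ` is a set coloring of the subdivided five-spoke wheel by subsets of `{1,…,k}`
such that every vertex receives at least `k/3` colors, then the hub `x` receives at most
`5k/9` colors. -/
theorem subdivided_wheel_center_bound (k : ℕ) (hk : 0 < k)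
    (φ : Fin 11 → Finset ℕ)
    (hsub : ∀ v, φ v ⊆ Finset.Icc 1 k)
    (hcol : ∀ ⦃u v⦄, subdividedWheel.Adj u v → Disjoint (φ u) (φ v))
    (hsize : ∀ v, (k : ℚ) / 3 ≤ ((φ v).card : ℚ)) :
    ((φ 0).card : ℚ) ≤ 5 * (k : ℚ) / 9 := by
  have hspoke (s r : Fin 11) (hxs : subdividedWheel.Adj 0 s) (hsr : subdividedWheel.Adj s r) :
      ((φ 0).card : ℚ) ≤ k / 3 + (φ 0 ∩ φ r).card := by
    have h := card_add_card_add_card_le_of_disjoint (hsub 0) (hsub s) (hsub r)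
      (hcol hxs) (hcol hsr)
    rw [Nat.card_Icc, Nat.add_sub_cancel] at h
    have h' : ((φ 0).card : ℚ) + (φ s).card + (φ r).card ≤ k + (φ 0 ∩ φ r).card := by
      exact_mod_cast h
    linarith [hsize s, hsize r]
  have hrim := sum_card_inter_le_of_disjoint_five_cycle (φ 0)
    ![φ 6, φ 7, φ 8, φ 9, φ 10] (by
      intro i
      fin_cases i <;> exact hcol (by simp [subdividedWheel]))
  simp only [Fin.sum_univ_five] at hrim
  have hrim' : ((φ 0 ∩ φ 6).card : ℚ) + (φ 0 ∩ φ 7).card + (φ 0 ∩ φ 8).card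
      + (φ 0 ∩ φ 9).card + (φ 0 ∩ φ 10).card ≤ 2 * (φ 0).card := by
    exact_mod_cast hrim
  have h1 := hspoke 1 6 (by simp [subdividedWheel]) (by simp [subdividedWheel])
  have h2 := hspoke 2 7 (by simp [subdividedWheel]) (by simp [subdividedWheel])
  have h3 := hspoke 3 8 (by simp [subdividedWheel]) (by simp [subdividedWheel])
  have h4 := hspoke 4 9 (by simp [subdividedWheel]) (by simp [subdividedWheel])
  have h5 := hspoke 5 10 (by simp [subdividedWheel]) (by simp [subdividedWheel])
  linarith
end
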